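/- (Harary's Balance Theorem) A signed graph (G, σ) is balanced if and only if there is a bipartition V(G) = V₁ ⊔ V₂ of the vertex set such that for every edge uv of G, σ(uv) = +1 if and only if u and v lie on the same side of the bipartition. -/

import Mathlib

namespace SignedPaper

variable {V : Type*}

/-- `σ` is a signature of `G`: symmetric, and valued in `{+1, -1}` on adjacent pairs. -/
def IsSignature (G : SimpleGraph V) (σ : V → V → ℤ) : Prop :=
  (∀ u v, σ u v = σ v u) ∧ ∀ ⦃u v⦄, G.Adj u v → σ u v = 1 ∨ σ u v = -1

/-- The switch of the signature `σ` at a vertex subset `U`: the sign of an edge is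
negated iff exactly one endpoint lies in `U`. -/
noncomputable def switch (σ : V → V → ℤ) (U : Set V) (u v : V) : ℤ :=
  @ite _ ((u ∈ U) ↔ (v ∈ U)) (Classical.propDecidable _) (σ u v) (-σ u v)

/-- The sign of a walk: the product of the signs of its edges. -/
def walkSign {G : SimpleGraph V} (σ : V → V → ℤ) : ∀ {u v : V}, G.Walk u v → ℤ
  | _, _, .nil => 1
  | _, _, @SimpleGraph.Walk.cons _ _ u x _ _ p => σ u x * walkSign σ p

/-- `(G, σ)` is balanced: every cycle is positive. -/
def IsBalanced (G : SimpleGraph V) (σ : V → V → ℤ) : Prop :=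
  ∀ ⦃v : V⦄ (W : G.Walk v v), W.IsCycle → walkSign σ W = 1

/-- A proper coloring of the signed graph `(G, σ)`. -/
def ProperColoring (G : SimpleGraph V) (σ : V → V → ℤ) (c : V → ℤ) : Prop :=
  ∀ ⦃u v⦄, G.Adj u v → c u ≠ σ u v * c v

/-- A proper `L`-coloring of the signed graph `(G, σ)`. -/
def ProperListColoring (G : SimpleGraph V) (σ : V → V → ℤ)
    (L : V → Finset ℤ) (c : V → ℤ) : Prop :=
  (∀ v, c v ∈ L v) ∧ ProperColoring G σ c

/-- `(G, σ)` is signed `k`-choosable. -/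
def SignedChoosable (G : SimpleGraph V) (σ : V → V → ℤ) (k : ℕ) : Prop :=
  ∀ L : V → Finset ℤ, (∀ v, k ≤ (L v).card) → ∃ c, ProperListColoring G σ L c

/-- The signed list chromatic number `χ_ℓ^s(G, σ)`. -/
noncomputable def signedChoiceNumber (G : SimpleGraph V) (σ : V → V → ℤ) : ℕ :=
  sInf {k | SignedChoosable G σ k}

/-- Classical (unsigned) `k`-choosability with integer colors. -/
def Choosable (G : SimpleGraph V) (k : ℕ) : Prop :=
  ∀ L : V → Finset ℤ, (∀ v, k ≤ (L v).card) →
    ∃ c : V → ℤ, (∀ v, c v ∈ L v) ∧ ∀ ⦃u v⦄, G.Adj u v → c u ≠ c v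

/-- The classical list chromatic number `χ_ℓ(G)`. -/
noncomputable def choiceNumber (G : SimpleGraph V) : ℕ :=
  sInf {k | Choosable G k}

theorem walkSign_append {G : SimpleGraph V} (σ : V → V → ℤ) {u v w : V} (p : G.Walk u v)
    (q : G.Walk v w) : walkSign σ (p.append q) = walkSign σ p * walkSign σ q := by
  induction p with
  | nil => simp [walkSign]
  | cons h p ih => simp [walkSign, ih, mul_assoc]

theorem walkSign_reverse {G : SimpleGraph V} {σ : V → V → ℤ} (hσ : IsSignature G σ) {u v : V}
    (p : G.Walk u v) : walkSign σ p.reverse = walkSign σ p := by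
  induction p with
  | nil => simp [walkSign]
  | cons h p ih =>
    rw [SimpleGraph.Walk.reverse_cons, walkSign_append, ih]
    simp only [walkSign, mul_one]
    rw [hσ.1, mul_comm]

theorem walkSign_eq {G : SimpleGraph V} {σ : V → V → ℤ} (hσ : IsSignature G σ) {u v : V}
    (p : G.Walk u v) : walkSign σ p = 1 ∨ walkSign σ p = -1 := by
  induction p with
  | nil => simp [walkSign]
  | cons h p ih =>
    simp only [walkSign]
    rcases hσ.2 h with h1 | h1 <;> rcases ih with h2 | h2 <;> simp [h1, h2]

theorem closed_path {G : SimpleGraph V} {σ : V → V → ℤ} (hσ : IsSignature G σ)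
    (hb : IsBalanced G σ) {u x : V} (h : G.Adj u x) (p : G.Walk x u) (hp : p.IsPath) :
    σ u x * walkSign σ p = 1 := by
  by_cases he : s(u, x) ∈ p.edges
  · cases p with
    | nil => simp at he
    | @cons _ w _ h' q =>
      rw [SimpleGraph.Walk.cons_isPath_iff] at hp
      rw [SimpleGraph.Walk.edges_cons, List.mem_cons] at he
      rcases he with he | he
      · have hw : u = w := by
          rw [Sym2.eq_swap] at he
          have hne := h'.ne
          simp at he
          tauto
        subst hw
        have hq : q = .nil := by simpa using hp.1
        subst hq
        simp only [walkSign, mul_one]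
        rw [hσ.1 x u]
        rcases hσ.2 h with h1 | h1 <;> simp [h1]
      · exact absurd (q.snd_mem_support_of_mem_edges he) hp.2
  · exact hb (.cons h p) ((SimpleGraph.Walk.cons_isCycle_iff p h).2 ⟨hp, he⟩)

theorem walkSign_bypass [DecidableEq V] {G : SimpleGraph V} {σ : V → V → ℤ}
    (hσ : IsSignature G σ)
    (hb : IsBalanced G σ) {u v : V} (p : G.Walk u v) :
    walkSign σ p.bypass = walkSign σ p := by
  induction p with
  | nil => rfl
  | @cons u x v h p ih =>
    simp only [SimpleGraph.Walk.bypass]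
    split_ifs with hs
    · have h1 := closed_path hσ hb h _ (p.bypass_isPath.takeUntil hs)
      have h2 := walkSign_append σ (p.bypass.takeUntil u hs) (p.bypass.dropUntil u hs)
      rw [SimpleGraph.Walk.take_spec, ih] at h2
      simp only [walkSign]
      rw [h2, ← mul_assoc, h1, one_mul]
    · simp only [walkSign, ih]

theorem walkSign_closed {G : SimpleGraph V} {σ : V → V → ℤ} (hσ : IsSignature G σ)
    (hb : IsBalanced G σ) {u : V} (p : G.Walk u u) : walkSign σ p = 1 := by
  classical
  rw [← walkSign_bypass hσ hb p]
  have : p.bypass = .nil := by simpa using p.bypass_isPath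
  rw [this]
  rfl

theorem walkSign_unique {G : SimpleGraph V} {σ : V → V → ℤ} (hσ : IsSignature G σ)
    (hb : IsBalanced G σ) {u v : V} (p q : G.Walk u v) : walkSign σ p = walkSign σ q := by
  have h := walkSign_closed hσ hb (p.append q.reverse)
  rw [walkSign_append, walkSign_reverse hσ] at h
  rcases walkSign_eq hσ p with h1 | h1 <;> rcases walkSign_eq hσ q with h2 | h2 <;>
    simp [h1, h2] at h ⊢

/-- Harary's Balance Theorem: `(G, σ)` is balanced iff there is a
bipartition `V = V₁ ⊔ V₂` (given by `V₁` and its complement) such that an edge is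
positive exactly when both its endpoints lie on the same side. -/
theorem harary_balance (G : SimpleGraph V) [Fintype V]
    (σ : V → V → ℤ) (hσ : IsSignature G σ) :
    IsBalanced G σ ↔
      ∃ V₁ : Set V, ∀ ⦃u v⦄, G.Adj u v → (σ u v = 1 ↔ ((u ∈ V₁) ↔ (v ∈ V₁))) := by
  constructor
  · intro hb
    refine ⟨{v | ∃ p : G.Walk v (G.connectedComponentMk v).out, walkSign σ p = 1}, ?_⟩
    intro u v h
    have hc : G.connectedComponentMk u = G.connectedComponentMk v :=
      SimpleGraph.ConnectedComponent.sound h.reachable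
    simp only [Set.mem_ofPred_eq]
    rw [hc]
    have hr : G.Reachable v (G.connectedComponentMk v).out :=
      SimpleGraph.ConnectedComponent.exact (Quot.out_eq (G.connectedComponentMk v)).symm
    obtain ⟨q⟩ := hr
    have key : ∀ {a b : V} (p : G.Walk a b), (∃ p' : G.Walk a b, walkSign σ p' = 1) ↔
        walkSign σ p = 1 := fun p =>
      ⟨fun ⟨p', hp'⟩ => (walkSign_unique hσ hb p p').trans hp', fun hp => ⟨p, hp⟩⟩
    rw [key q, key (.cons h q)]
    simp only [walkSign]
    rcases hσ.2 h with h1 | h1 <;> rcases walkSign_eq hσ q with h2 | h2 <;> simp [h1, h2]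
  · rintro ⟨V₁, hV⟩ v W -
    have key : ∀ {a b : V} (p : G.Walk a b), walkSign σ p = 1 ↔ (a ∈ V₁ ↔ b ∈ V₁) := by
      intro a b p
      induction p with
      | nil => simp [walkSign]
      | cons h p ih =>
        have h0 := hV h
        simp only [walkSign]
        rcases hσ.2 h with h1 | h1 <;> rcases walkSign_eq hσ p with h2 | h2 <;>
          simp [h1, h2] at h0 ih ⊢ <;> tauto
    exact (key W).2 Iff.rfl

end SignedPaper
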